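/- arXiv:1809.00752 — 2 statements merged into one kernel-verified Lean document; each statement's English description precedes it below -/
import Mathlib

section
/- Let λ* ∈ Δ(X) achieve the channel capacity, with Q* = λ*Φ and Q*_j > 0 for all j, and let J(λ*) be the Jacobian matrix of the Arimoto map F at λ*. Suppose the spectral radius θ_max of J(λ*) satisfies θ_max < 1. Then for any θ with θ_max < θ < 1 there exist δ > 0 and K > 0 such that for every initial distribution λ⁰ ∈ Δ(X) with ‖λ⁰ − λ*‖ < δ, the Arimoto sequence λ^{N+1} = F(λ^N) satisfies ‖λ^N − λ*‖ ≤ K θ^N for all N = 0,1,2,…, where ‖·‖ is the Euclidean norm on ℝ^m; i.e., the convergence is exponential. (Theorem 5) -/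
open scoped BigOperators

noncomputable section

/-- The simplex of probability vectors on `Fin m`. -/
def chSimplex (m : ℕ) : Set (Fin m → ℝ) :=
  {l | (∀ i, 0 ≤ l i) ∧ ∑ i, l i = 1}

/-- The output distribution `λΦ` of the channel `P` for input distribution `l`. -/
def chOut {m n : ℕ} (P : Matrix (Fin m) (Fin n) ℝ) (l : Fin m → ℝ) (j : Fin n) : ℝ :=
  ∑ i, l i * P i j

/-- Kullback-Leibler divergence `D(Q‖Q')`. -/
def chKL {n : ℕ} (Q Q' : Fin n → ℝ) : ℝ :=
  ∑ j, Q j * Real.log (Q j / Q' j)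

/-- Mutual information `I(λ,Φ)`. -/
def chMI {m n : ℕ} (P : Matrix (Fin m) (Fin n) ℝ) (l : Fin m → ℝ) : ℝ :=
  ∑ i, ∑ j, l i * P i j * Real.log (P i j / chOut P l j)

/-- The Arimoto map `F(λ)`, componentwise. -/
def chAF {m n : ℕ} (P : Matrix (Fin m) (Fin n) ℝ) (l : Fin m → ℝ) (i : Fin m) : ℝ :=
  l i * Real.exp (chKL (P i) (chOut P l)) /
    ∑ k, l k * Real.exp (chKL (P k) (chOut P l))

/-- Partial derivative `∂f/∂λ_{i'}` at `x`, treating the coordinates as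
independent variables. -/
def chPd {m : ℕ} (f : (Fin m → ℝ) → ℝ) (i' : Fin m) (x : Fin m → ℝ) : ℝ :=
  fderiv ℝ f x (Pi.single i' 1)

/-- Second partial derivative `∂²f/∂λ_{i'}∂λ_{i''}` at `x`. -/
def chPd2 {m : ℕ} (f : (Fin m → ℝ) → ℝ) (i' i'' : Fin m) (x : Fin m → ℝ) : ℝ :=
  chPd (chPd f i'') i' x

open Filter Topology Asymptotics

/-- If some power of the derivative of `F` at a fixed point has norm less than `θ ^ N`, then the
iterates of `F` converge to the fixed point at rate `θ` from nearby starting points. -/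
theorem exists_norm_iterate_sub_le_of_norm_fderiv_pow_lt {E : Type*} [NormedAddCommGroup E]
    [NormedSpace ℝ E] {F : E → E} {A : E →L[ℝ] E} {x₀ : E} (hfix : F x₀ = x₀)
    (hF : HasFDerivAt F A x₀) {θ : ℝ} (hθ0 : 0 < θ) (hθ1 : θ < 1) {N : ℕ} (hN : 0 < N)
    (hA : ‖A ^ N‖ < θ ^ N) :
    ∃ δ > 0, ∃ K > 0, ∀ x, ‖x - x₀‖ < δ → ∀ k, ‖F^[k] x - x₀‖ ≤ K * θ ^ k * ‖x - x₀‖ := by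
  have hlip : ∀ r : ℕ, ∀ c : ℝ, ‖A ^ r‖ < c →
      ∀ᶠ x in 𝓝 x₀, ‖F^[r] x - x₀‖ ≤ c * ‖x - x₀‖ := by
    intro r c hc
    have h := (hF.iterate hfix r).isLittleO.def (sub_pos.2 hc)
    filter_upwards [h] with x hx
    rw [Function.iterate_fixed hfix] at hx
    calc ‖F^[r] x - x₀‖ = ‖(F^[r] x - x₀ - (A ^ r) (x - x₀)) + (A ^ r) (x - x₀)‖ := by
          rw [sub_add_cancel]
      _ ≤ (c - ‖A ^ r‖) * ‖x - x₀‖ + ‖A ^ r‖ * ‖x - x₀‖ :=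
          (norm_add_le _ _).trans (add_le_add hx ((A ^ r).le_opNorm _))
      _ = c * ‖x - x₀‖ := by ring
  obtain ⟨M, hM⟩ : ∃ M, ∀ r ∈ Finset.range N, ‖A ^ r‖ ≤ M :=
    ((Finset.range N).image fun r => ‖A ^ r‖).bddAbove.imp fun M h r hr =>
      h (by simpa using ⟨r, by simpa using hr, rfl⟩)
  have hM0 : 0 ≤ M := (norm_nonneg _).trans (hM 0 (by simpa using hN))
  have hall : ∀ᶠ x in 𝓝 x₀, ‖F^[N] x - x₀‖ ≤ θ ^ N * ‖x - x₀‖ ∧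
      ∀ r ∈ Finset.range N, ‖F^[r] x - x₀‖ ≤ (M + 1) * ‖x - x₀‖ :=
    (hlip N _ hA).and <| (Finset.eventually_all _).2 fun r hr =>
      hlip r _ (by linarith [hM r hr])
  obtain ⟨δ, hδ, hball⟩ := Metric.eventually_nhds_iff.1 hall
  have hblock : ∀ q : ℕ, ∀ x, ‖x - x₀‖ < δ →
      ‖(F^[N])^[q] x - x₀‖ ≤ (θ ^ N) ^ q * ‖x - x₀‖ := by
    intro q x hx
    induction q with
    | zero => simp
    | succ q ih =>
      have hle : (θ ^ N) ^ q ≤ 1 := pow_le_one₀ (by positivity) (pow_le_one₀ hθ0.le hθ1.le)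
      have hlt : ‖(F^[N])^[q] x - x₀‖ < δ :=
        (ih.trans (mul_le_of_le_one_left (norm_nonneg _) hle)).trans_lt hx
      rw [Function.iterate_succ_apply']
      calc _ ≤ θ ^ N * ‖(F^[N])^[q] x - x₀‖ := (hball (by rwa [dist_eq_norm])).1
        _ ≤ θ ^ N * ((θ ^ N) ^ q * ‖x - x₀‖) := by gcongr
        _ = _ := by ring
  refine ⟨δ, hδ, (M + 1) / θ ^ N, by positivity, fun x hx k => ?_⟩
  have hle : (θ ^ N) ^ (k / N) ≤ 1 := pow_le_one₀ (by positivity) (pow_le_one₀ hθ0.le hθ1.le)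
  have hlt : ‖(F^[N])^[k / N] x - x₀‖ < δ :=
    ((hblock _ x hx).trans (mul_le_of_le_one_left (norm_nonneg _) hle)).trans_lt hx
  have hk : F^[k] x = F^[k % N] ((F^[N])^[k / N] x) := by
    rw [← Function.iterate_mul, ← Function.iterate_add_apply, Nat.mod_add_div]
  have hpow : (θ ^ N) ^ (k / N) * θ ^ N ≤ θ ^ k := by
    rw [← pow_mul, ← pow_add]
    refine pow_le_pow_of_le_one hθ0.le hθ1.le ?_
    have h1 := Nat.mod_add_div k N
    have h2 := Nat.mod_lt k hN
    omega
  rw [hk]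
  calc _ ≤ (M + 1) * ‖(F^[N])^[k / N] x - x₀‖ :=
        (hball (by rwa [dist_eq_norm])).2 _ (Finset.mem_range.2 (Nat.mod_lt k hN))
    _ ≤ (M + 1) * ((θ ^ N) ^ (k / N) * ‖x - x₀‖) := by gcongr; exact hblock _ x hx
    _ ≤ (M + 1) * (θ ^ k / θ ^ N * ‖x - x₀‖) := by
        gcongr
        rwa [le_div_iff₀ (by positivity)]
    _ = _ := by ring

section MatrixNorm

attribute [local instance] Matrix.linftyOpNormedRing Matrix.linftyOpNormedAlgebra

theorem spectrum_transpose {ι : Type*} [Fintype ι] [DecidableEq ι] (B : Matrix ι ι ℂ) :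
    spectrum ℂ B.transpose = spectrum ℂ B := by
  ext z
  rw [spectrum.mem_iff, spectrum.mem_iff, ← Matrix.isUnit_transpose]
  simp [Matrix.transpose_sub, Matrix.algebraMap_eq_diagonal]

/-- A real matrix whose complex spectral radius is less than `θ` has a power acting on row vectors
with operator norm less than `θ ^ N`. -/
theorem exists_norm_pow_lt_of_spectralRadius_lt {ι : Type*} [Fintype ι] [DecidableEq ι]
    {J : Matrix ι ι ℝ} {A : (ι → ℝ) →L[ℝ] (ι → ℝ)} (hA : ∀ v, A v = Matrix.vecMul v J) {θ : ℝ}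
    (hθ : spectralRadius ℂ (J.map fun x => (x : ℂ)) < ENNReal.ofReal θ) :
    ∃ N, 0 < N ∧ ‖A ^ N‖ < θ ^ N := by
  have hθ0 : 0 < θ := ENNReal.ofReal_pos.1 (bot_le.trans_lt hθ)
  set B : Matrix ι ι ℂ := J.transpose.map fun x => (x : ℂ) with hB
  have hBr : spectralRadius ℂ B < ENNReal.ofReal θ := by
    unfold spectralRadius at hθ ⊢
    rwa [hB, Matrix.transpose_map, spectrum_transpose]
  obtain ⟨N, hlt, hN⟩ := (((spectrum.pow_nnnorm_pow_one_div_tendsto_nhds_spectralRadius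
    B).eventually_lt_const hBr).and (eventually_gt_atTop 0)).exists
  have hBN : ‖B ^ N‖ < θ ^ N := by
    have h := ENNReal.pow_lt_pow_left hN.ne' hlt
    rw [← ENNReal.rpow_natCast, ← ENNReal.rpow_mul, one_div,
      inv_mul_cancel₀ (by exact_mod_cast hN.ne'), ENNReal.rpow_one, ← ENNReal.ofReal_pow hθ0.le,
      ← enorm_eq_nnnorm, ← ofReal_norm] at h
    exact (ENNReal.ofReal_lt_ofReal_iff (by positivity)).1 h
  have hpow : B ^ N = (J.transpose ^ N).map fun x => (x : ℂ) :=
    (map_pow (Complex.ofRealHom.mapMatrix : Matrix ι ι ℝ →+* _) J.transpose N).symm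
  have hnorm : ‖J.transpose ^ N‖ = ‖B ^ N‖ := by
    rw [hpow, Matrix.linfty_opNorm_def, Matrix.linfty_opNorm_def]
    simp
  have hAN : ∀ k v, (A ^ k) v = Matrix.mulVec (J.transpose ^ k) v := by
    intro k v
    induction k with
    | zero => simp
    | succ k ih =>
      rw [pow_succ', pow_succ', mul_apply_eq_comp, ih, hA, ← Matrix.mulVec_mulVec,
        Matrix.mulVec_transpose]
  refine ⟨N, hN, lt_of_le_of_lt ?_ hBN⟩
  refine ContinuousLinearMap.opNorm_le_bound _ (norm_nonneg _) fun v => ?_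
  rw [hAN, ← hnorm]
  exact Matrix.linfty_opNorm_mulVec _ _

end MatrixNorm

theorem norm_le_sqrt_sum_sq {ι : Type*} [Fintype ι] (v : ι → ℝ) :
    ‖v‖ ≤ Real.sqrt (∑ i, v i ^ 2) := by
  refine (pi_norm_le_iff_of_nonneg (Real.sqrt_nonneg _)).2 fun i => ?_
  rw [Real.norm_eq_abs]
  exact Real.abs_le_sqrt
    (Finset.single_le_sum (f := fun i => v i ^ 2) (fun i _ => sq_nonneg _) (Finset.mem_univ i))

theorem sqrt_sum_sq_le_card_mul_norm {ι : Type*} [Fintype ι] (v : ι → ℝ) :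
    Real.sqrt (∑ i, v i ^ 2) ≤ Real.sqrt (Fintype.card ι) * ‖v‖ := by
  have h : ∑ i, v i ^ 2 ≤ Fintype.card ι * ‖v‖ ^ 2 := by
    have := Finset.sum_le_card_nsmul Finset.univ (fun i => v i ^ 2) (‖v‖ ^ 2) fun i _ => by
      rw [← sq_abs, ← Real.norm_eq_abs]
      exact pow_le_pow_left₀ (norm_nonneg _) (norm_le_pi_norm v i) 2
    simpa using this
  calc _ ≤ Real.sqrt (Fintype.card ι * ‖v‖ ^ 2) := Real.sqrt_le_sqrt h
    _ = _ := by rw [Real.sqrt_mul (by positivity), Real.sqrt_sq (norm_nonneg _)]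

section Channel

variable {m n : ℕ} {P : Matrix (Fin m) (Fin n) ℝ}

theorem chKL_le_sum_sq_div {Q Q' : Fin n → ℝ} (hQ : ∀ j, 0 < Q j) (hQ' : ∀ j, 0 < Q' j)
    (hsum : ∑ j, Q j = ∑ j, Q' j) : chKL Q Q' ≤ ∑ j, (Q j - Q' j) ^ 2 / Q' j := by
  have h : ∑ j, (Q j - Q' j) ^ 2 / Q' j = ∑ j, Q j * (Q j / Q' j - 1) := by
    have : ∑ j, (Q j - Q' j) ^ 2 / Q' j =
        ∑ j, Q j * (Q j / Q' j - 1) - (∑ j, Q j - ∑ j, Q' j) := by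
      rw [← Finset.sum_sub_distrib, ← Finset.sum_sub_distrib]
      refine Finset.sum_congr rfl fun j _ => ?_
      have := (hQ' j).ne'
      field_simp
    rw [this, hsum, sub_self, sub_zero]
  rw [h]
  exact Finset.sum_le_sum fun j _ => mul_le_mul_of_nonneg_left
    (Real.log_le_sub_one_of_pos (div_pos (hQ j) (hQ' j))) (hQ j).le

theorem sum_chOut (hProw : ∀ i, ∑ j, P i j = 1) (l : Fin m → ℝ) :
    ∑ j, chOut P l j = ∑ i, l i := by
  simp only [chOut]
  rw [Finset.sum_comm]
  simp [← Finset.mul_sum, hProw]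

/-- Topsøe's identity, comparing the mutual information with the divergences to an arbitrary
output distribution. -/
theorem chMI_eq_sum_chKL_sub {l : Fin m → ℝ} {Q : Fin n → ℝ} (hl : ∀ j, 0 < chOut P l j)
    (hQ : ∀ j, 0 < Q j) :
    chMI P l = ∑ i, l i * chKL (P i) Q - chKL (chOut P l) Q := by
  have h1 : chKL (chOut P l) Q = ∑ i, ∑ j, l i * P i j * Real.log (chOut P l j / Q j) := by
    rw [Finset.sum_comm]
    simp only [chKL, ← Finset.sum_mul]
    rfl
  rw [h1, ← Finset.sum_sub_distrib]
  refine Finset.sum_congr rfl fun i _ => ?_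
  rw [chKL, Finset.mul_sum, ← Finset.sum_sub_distrib]
  refine Finset.sum_congr rfl fun j _ => ?_
  rcases eq_or_ne (P i j) 0 with h | h
  · simp [h]
  · rw [Real.log_div h (hl j).ne', Real.log_div h (hQ j).ne', Real.log_div (hl j).ne' (hQ j).ne']
    ring

theorem chMI_eq_sum_chKL {l : Fin m → ℝ} : chMI P l = ∑ i, l i * chKL (P i) (chOut P l) := by
  simp only [chMI, chKL, Finset.mul_sum, mul_assoc]

/-- At a capacity-achieving distribution no row has divergence above the capacity. -/
theorem chKL_le_of_chMI_max (hPnn : ∀ i j, 0 ≤ P i j) (hProw : ∀ i, ∑ j, P i j = 1)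
    {l : Fin m → ℝ} (hl : l ∈ chSimplex m) (hmax : ∀ l' ∈ chSimplex m, chMI P l' ≤ chMI P l)
    (hQ : ∀ j, 0 < chOut P l j) (i : Fin m) : chKL (P i) (chOut P l) ≤ chMI P l := by
  set Q := chOut P l with hQdef
  set χ := ∑ j, (P i j - Q j) ^ 2 / Q j
  have hχ : 0 ≤ χ := Finset.sum_nonneg fun j _ => div_nonneg (sq_nonneg _) (hQ j).le
  have key : ∀ t : ℝ, 0 < t → t < 1 → chKL (P i) Q - chMI P l ≤ t * χ := by
    intro t ht0 ht1
    set μ : Fin m → ℝ := fun k => (1 - t) * l k + t * Pi.single (M := fun _ => ℝ) i 1 k with hμ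
    have hμs : μ ∈ chSimplex m := by
      refine ⟨fun k => ?_, ?_⟩
      · have h1 : 0 ≤ Pi.single (M := fun _ => ℝ) i 1 k := by
          by_cases h : k = i
          · subst h; simp
          · simp [h]
        have h2 := hl.1 k
        have h3 : 0 ≤ 1 - t := by linarith
        simp only [hμ]
        positivity
      · simp [hμ, Finset.sum_add_distrib, ← Finset.mul_sum, hl.2]
    have hout : ∀ j, chOut P μ j = (1 - t) * Q j + t * P i j := by
      intro j
      simp [chOut, hμ, hQdef, add_mul, Finset.sum_add_distrib, Finset.mul_sum, mul_assoc,
        Pi.single_apply]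
    have hpos : ∀ j, 0 < chOut P μ j := fun j => by
      rw [hout]
      have := mul_pos (sub_pos.2 ht1) (hQ j)
      have := mul_nonneg ht0.le (hPnn i j)
      linarith
    have h1 := hmax μ hμs
    rw [chMI_eq_sum_chKL_sub hpos hQ] at h1
    have h2 : ∑ k, μ k * chKL (P k) Q = (1 - t) * chMI P l + t * chKL (P i) Q := by
      rw [chMI_eq_sum_chKL, ← hQdef]
      simp [hμ, add_mul, Finset.sum_add_distrib, Finset.mul_sum, mul_assoc, Pi.single_apply]
    have h3 : chKL (chOut P μ) Q ≤ t ^ 2 * χ := by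
      refine (chKL_le_sum_sq_div hpos hQ ?_).trans_eq ?_
      · rw [hQdef, sum_chOut hProw, sum_chOut hProw, hμs.2, hl.2]
      · rw [Finset.mul_sum]
        refine Finset.sum_congr rfl fun j _ => ?_
        rw [hout]
        ring
    rw [h2] at h1
    have h4 : t * (chKL (P i) Q - chMI P l) ≤ t * (t * χ) := by nlinarith
    exact le_of_mul_le_mul_left h4 ht0
  by_contra! hlt
  have hd : 0 < chKL (P i) Q - chMI P l := sub_pos.2 hlt
  set d := chKL (P i) Q - chMI P l
  have h := key (d / (d + χ + d)) (by positivity) (by rw [div_lt_one (by positivity)]; linarith)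
  rw [div_mul_eq_mul_div, le_div_iff₀ (by positivity)] at h
  nlinarith

theorem chKL_eq_of_chMI_max (hPnn : ∀ i j, 0 ≤ P i j) (hProw : ∀ i, ∑ j, P i j = 1)
    {l : Fin m → ℝ} (hl : l ∈ chSimplex m) (hmax : ∀ l' ∈ chSimplex m, chMI P l' ≤ chMI P l)
    (hQ : ∀ j, 0 < chOut P l j) {i : Fin m} (hi : l i ≠ 0) :
    chKL (P i) (chOut P l) = chMI P l := by
  have hnn : ∀ k ∈ Finset.univ, 0 ≤ l k * (chMI P l - chKL (P k) (chOut P l)) := fun k _ =>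
    mul_nonneg (hl.1 k) (sub_nonneg.2 (chKL_le_of_chMI_max hPnn hProw hl hmax hQ k))
  have hzero : ∑ k, l k * (chMI P l - chKL (P k) (chOut P l)) = 0 := by
    simp only [mul_sub, Finset.sum_sub_distrib, ← Finset.sum_mul, hl.2]
    rw [← chMI_eq_sum_chKL]
    ring
  have h := (Finset.sum_eq_zero_iff_of_nonneg hnn).1 hzero i (Finset.mem_univ i)
  linarith [(mul_eq_zero.1 h).resolve_left hi]

/-- A capacity-achieving distribution is a fixed point of the Arimoto map. -/
theorem chAF_eq_self_of_chMI_max (hPnn : ∀ i j, 0 ≤ P i j) (hProw : ∀ i, ∑ j, P i j = 1)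
    {l : Fin m → ℝ} (hl : l ∈ chSimplex m) (hmax : ∀ l' ∈ chSimplex m, chMI P l' ≤ chMI P l)
    (hQ : ∀ j, 0 < chOut P l j) : chAF P l = l := by
  have h : ∀ k, l k * Real.exp (chKL (P k) (chOut P l)) = l k * Real.exp (chMI P l) := by
    intro k
    by_cases hk : l k = 0
    · simp [hk]
    · rw [chKL_eq_of_chMI_max hPnn hProw hl hmax hQ hk]
  funext i
  simp only [chAF, h, ← Finset.sum_mul, hl.2, one_mul]
  exact mul_div_cancel_right₀ _ (Real.exp_ne_zero _)

theorem differentiableAt_chAF {l : Fin m → ℝ} (hl : l ∈ chSimplex m)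
    (hQ : ∀ j, 0 < chOut P l j) : DifferentiableAt ℝ (chAF P) l := by
  have hout : ∀ j, DifferentiableAt ℝ (fun x => chOut P x j) l := fun j => by
    unfold chOut
    fun_prop
  have hKL : ∀ i, DifferentiableAt ℝ (fun x => chKL (P i) (chOut P x)) l := fun i => by
    unfold chKL
    refine DifferentiableAt.fun_sum fun j _ => ?_
    by_cases h : P i j = 0
    · simp [h]
    · simp only [div_eq_mul_inv]
      exact ((((hout j).fun_inv (hQ j).ne').const_mul _).log
        (mul_ne_zero h (inv_ne_zero (hQ j).ne'))).const_mul _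
  have hnum : ∀ i, DifferentiableAt ℝ (fun x => x i * Real.exp (chKL (P i) (chOut P x))) l :=
    fun i => (differentiableAt_apply i l).mul (hKL i).exp
  have hden : ∑ k, l k * Real.exp (chKL (P k) (chOut P l)) ≠ 0 := by
    intro h
    have h0 := (Finset.sum_eq_zero_iff_of_nonneg fun k _ =>
      mul_nonneg (hl.1 k) (Real.exp_pos _).le).1 h
    have : ∑ k, l k = 0 := Finset.sum_eq_zero fun k hk =>
      (mul_eq_zero.1 (h0 k hk)).resolve_right (Real.exp_ne_zero _)
    exact one_ne_zero (hl.2.symm.trans this)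
  refine differentiableAt_pi.2 fun i => ?_
  simp only [chAF, div_eq_mul_inv]
  exact (hnum i).mul ((DifferentiableAt.fun_sum fun k _ => hnum k).fun_inv hden)

end Channel

/-- **Theorem 5.** If the spectral radius `θ_max` of the Jacobian `J(λ*)` of
the Arimoto map at the capacity-achieving distribution satisfies
`θ_max < 1`, then for any `θ` with `θ_max < θ < 1` there exist `δ > 0` and
`K > 0` such that the Arimoto iterates starting within distance `δ` of `λ*`
satisfy `‖λ^N − λ*‖ ≤ K θ^N` (Euclidean norm): exponential convergence. -/
theorem stmt_8 (m n : ℕ) (P : Matrix (Fin m) (Fin n) ℝ)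
    (hPnn : ∀ i j, 0 ≤ P i j) (hProw : ∀ i, ∑ j, P i j = 1)
    (hPcol : ∀ j, ∃ i, 0 < P i j)
    (C : ℝ) (hub : ∀ l ∈ chSimplex m, chMI P l ≤ C)
    (lstar : Fin m → ℝ) (hls : lstar ∈ chSimplex m) (hach : chMI P lstar = C)
    (hQpos : ∀ j, 0 < chOut P lstar j)
    (J : Matrix (Fin m) (Fin m) ℝ)
    (hJ : ∀ i' i, J i' i = chPd (fun x => chAF P x i) i' lstar)
    (hmax : spectralRadius ℂ (J.map fun x => (x : ℂ)) < 1)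
    (θ : ℝ) (hθ₁ : spectralRadius ℂ (J.map fun x => (x : ℂ)) < ENNReal.ofReal θ)
    (hθ₂ : θ < 1) :
    ∃ δ > 0, ∃ K > 0, ∀ lam : ℕ → Fin m → ℝ,
      lam 0 ∈ chSimplex m →
      Real.sqrt (∑ i, (lam 0 i - lstar i) ^ 2) < δ →
      (∀ N, lam (N + 1) = chAF P (lam N)) →
      ∀ N, Real.sqrt (∑ i, (lam N i - lstar i) ^ 2) ≤ K * θ ^ N := by
  have hmaxI : ∀ l' ∈ chSimplex m, chMI P l' ≤ chMI P lstar := fun l' hl' =>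
    (hub l' hl').trans_eq hach.symm
  have hfix := chAF_eq_self_of_chMI_max hPnn hProw hls hmaxI hQpos
  have hdiff := differentiableAt_chAF hls hQpos
  have hA : ∀ v, fderiv ℝ (chAF P) lstar v = Matrix.vecMul v J := by
    intro v
    have hcomp : ∀ i w, fderiv ℝ (chAF P) lstar w i = fderiv ℝ (fun x => chAF P x i) lstar w :=
      fun i w => by
        rw [((hasFDerivAt_pi'.1 hdiff.hasFDerivAt) i).fderiv]
        rfl
    funext i
    rw [hcomp, Matrix.vecMul_eq_sum, Finset.sum_apply]
    conv_lhs => rw [pi_eq_sum_univ' v, map_sum]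
    refine Finset.sum_congr rfl fun k _ => ?_
    rw [map_smul]
    exact congrArg (v k • ·) (hJ k i).symm
  obtain ⟨N, hN, hAN⟩ := exists_norm_pow_lt_of_spectralRadius_lt hA hθ₁
  have hθ0 : 0 < θ := ENNReal.ofReal_pos.1 (bot_le.trans_lt hθ₁)
  obtain ⟨δ, hδ, K, hK, hconv⟩ := exists_norm_iterate_sub_le_of_norm_fderiv_pow_lt hfix
    hdiff.hasFDerivAt hθ0 hθ₂ hN hAN
  refine ⟨δ, hδ, Real.sqrt m * (K * δ) + 1, by positivity, fun lam _ h0 hstep k => ?_⟩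
  have hiter : ∀ k, lam k = (chAF P)^[k] (lam 0) := by
    intro k
    induction k with
    | zero => rfl
    | succ k ih => rw [hstep, ih, Function.iterate_succ_apply']
  have hlt : ‖lam 0 - lstar‖ < δ := (norm_le_sqrt_sum_sq (lam 0 - lstar)).trans_lt h0
  calc Real.sqrt (∑ i, (lam k i - lstar i) ^ 2)
      ≤ Real.sqrt m * ‖lam k - lstar‖ := by
        simpa using sqrt_sum_sq_le_card_mul_norm (lam k - lstar)
    _ ≤ Real.sqrt m * (K * θ ^ k * δ) := by
        gcongr
        rw [hiter k]
        exact (hconv _ hlt k).trans (by gcongr)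
    _ ≤ (Real.sqrt m * (K * δ) + 1) * θ ^ k := by
        have : 0 < θ ^ k := by positivity
        linarith
end
end

section
/- Let λ* ∈ Δ(X) achieve the channel capacity C, with Q* = λ*Φ and Q*_j > 0 for all j, and suppose that D(P^i‖Q*) = C for every i ∈ {1,…,m} (i.e., there is no type III index). Then for every i with λ*_i = 0 and all i', i'' ∈ {1,…,m}: ∂²F_i/∂λ_{i'}∂λ_{i''}(λ*) = δ_{ii'} D*_{i,i''} + δ_{ii''} D*_{i,i'}, where D*_{i,k} = −Σ_j P^k_j P^i_j / Q*_j. (Theorem 6, special case) -/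
open scoped BigOperators

noncomputable section

/-- The linear functional `l ↦ (lΦ)_j`. -/
def chOutCLM {m n : ℕ} (P : Matrix (Fin m) (Fin n) ℝ) (j : Fin n) : (Fin m → ℝ) →L[ℝ] ℝ :=
  ∑ i, P i j • ContinuousLinearMap.proj (R := ℝ) (φ := fun _ : Fin m => ℝ) i

lemma chOutCLM_apply {m n : ℕ} (P : Matrix (Fin m) (Fin n) ℝ) (j : Fin n) (l : Fin m → ℝ) :
    chOutCLM P j l = chOut P l j := by
  simp [chOutCLM, chOut, mul_comm]

lemma chOut_single {m n : ℕ} (P : Matrix (Fin m) (Fin n) ℝ) (j : Fin n) (k : Fin m) :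
    chOut P (Pi.single k 1) j = P k j := by
  simp [chOut, Pi.single_apply]

lemma contDiff_chOut {m n : ℕ} (P : Matrix (Fin m) (Fin n) ℝ) (j : Fin n) {r : WithTop ℕ∞} :
    ContDiff ℝ r (fun l => chOut P l j) :=
  (funext (chOutCLM_apply P j) : ⇑(chOutCLM P j) = _) ▸ (chOutCLM P j).contDiff

lemma hasFDerivAt_chOut {m n : ℕ} (P : Matrix (Fin m) (Fin n) ℝ) (j : Fin n) (l : Fin m → ℝ) :
    HasFDerivAt (fun l => chOut P l j) (chOutCLM P j) l :=
  (chOutCLM P j).hasFDerivAt.congr_of_eventuallyEq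
    (Filter.Eventually.of_forall fun x => (chOutCLM_apply P j x).symm)

lemma contDiffAt_chKL {m n : ℕ} (P : Matrix (Fin m) (Fin n) ℝ) (Q : Fin n → ℝ) {l : Fin m → ℝ}
    (hl : ∀ j, 0 < chOut P l j) {r : WithTop ℕ∞} :
    ContDiffAt ℝ r (fun x => chKL Q (chOut P x)) l := by
  unfold chKL
  refine ContDiffAt.sum fun j _ => ?_
  by_cases hQ : Q j = 0
  · simpa [hQ] using contDiffAt_const
  · exact contDiffAt_const.mul ((contDiffAt_const.div (contDiff_chOut P j).contDiffAt
      (hl j).ne').log (div_ne_zero hQ (hl j).ne'))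

lemma hasFDerivAt_chKL {m n : ℕ} (P : Matrix (Fin m) (Fin n) ℝ) (Q : Fin n → ℝ) {l : Fin m → ℝ}
    (hl : ∀ j, 0 < chOut P l j) :
    HasFDerivAt (fun x => chKL Q (chOut P x))
      (∑ j, (-(Q j / chOut P l j)) • chOutCLM P j) l := by
  unfold chKL
  refine HasFDerivAt.fun_sum fun j _ => ?_
  by_cases hQ : Q j = 0
  · simpa [hQ] using hasFDerivAt_const (0 : ℝ) l
  · have hd : HasDerivAt (fun t => Q j * Real.log (Q j / t)) (-(Q j / chOut P l j))
        (chOut P l j) := by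
      have h0 := (hl j).ne'
      have h1 := ((((hasDerivAt_const (chOut P l j) (Q j)).fun_div (hasDerivAt_id' _) h0).log
        (div_ne_zero hQ h0)).const_mul (Q j))
      refine h1.congr_deriv ?_
      field_simp
      ring
    exact HasDerivAt.comp_hasFDerivAt (f := fun x => chOut P x j) l hd (hasFDerivAt_chOut P j l)

/-- Second partial derivatives of `y ↦ y i * g y` at a zero of the `i`-th coordinate. -/
lemma chPd2_coord_mul {m : ℕ} {g : (Fin m → ℝ) → ℝ} {x : Fin m → ℝ} (hg : ContDiffAt ℝ 2 g x)
    {i : Fin m} (hi : x i = 0) (i' i'' : Fin m) :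
    chPd2 (fun y => y i * g y) i' i'' x
      = (if i = i' then (1 : ℝ) else 0) * chPd g i'' x
        + (if i = i'' then (1 : ℝ) else 0) * chPd g i' x := by
  have hp (y : Fin m → ℝ) : HasFDerivAt (fun y : Fin m → ℝ => y i)
      (ContinuousLinearMap.proj (R := ℝ) (φ := fun _ : Fin m => ℝ) i) y := hasFDerivAt_apply i y
  have hev : ∀ᶠ y in nhds x, DifferentiableAt ℝ g y :=
    (hg.eventually (by simp)).mono fun y hy => hy.differentiableAt (by simp)
  have heq : chPd (fun y => y i * g y) i'' =ᶠ[nhds x]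
      fun y => y i * chPd g i'' y + g y * (if i = i'' then (1 : ℝ) else 0) := by
    filter_upwards [hev] with y hy
    rw [chPd, ((hp y).fun_mul hy.hasFDerivAt).fderiv]
    simp [chPd, Pi.single_apply]
  have hd : DifferentiableAt ℝ (chPd g i'') x :=
    ((hg.fderiv_right (m := 1) (by norm_num)).differentiableAt (by simp)).clm_apply
      (differentiableAt_const _)
  have hgd : DifferentiableAt ℝ g x := hg.differentiableAt (by simp)
  rw [chPd2, chPd, heq.fderiv_eq, (((hp x).fun_mul hd.hasFDerivAt).fun_add
    (hgd.hasFDerivAt.mul_const _)).fderiv]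
  simp only [hi]
  by_cases h : i = i'' <;> simp [chPd, Pi.single_apply, h, add_comm]

/-- **Theorem 6 (special case).** If there is no type III index
(`D(P^i‖Q*) = C` for all `i`), then for every `i` with `λ*_i = 0`:
`∂²F_i/∂λ_{i'}∂λ_{i''}(λ*) = δ_{ii'} D*_{i,i''} + δ_{ii''} D*_{i,i'}`. -/
theorem stmt_10 (m n : ℕ) (P : Matrix (Fin m) (Fin n) ℝ)
    (hPnn : ∀ i j, 0 ≤ P i j) (hProw : ∀ i, ∑ j, P i j = 1)
    (hPcol : ∀ j, ∃ i, 0 < P i j)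
    (C : ℝ) (hub : ∀ l ∈ chSimplex m, chMI P l ≤ C)
    (lstar : Fin m → ℝ) (hls : lstar ∈ chSimplex m) (hach : chMI P lstar = C)
    (hQpos : ∀ j, 0 < chOut P lstar j)
    (hallC : ∀ i, chKL (P i) (chOut P lstar) = C)
    (D2 : Fin m → Fin m → ℝ)
    (hD2 : ∀ i k, D2 i k = -∑ j, P k j * P i j / chOut P lstar j)
    (i : Fin m) (hi : lstar i = 0) (i' i'' : Fin m) :
    chPd2 (fun x => chAF P x i) i' i'' lstar
      = (if i = i' then (1 : ℝ) else 0) * D2 i i''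
        + (if i = i'' then (1 : ℝ) else 0) * D2 i i' := by
  set Z : (Fin m → ℝ) → ℝ := fun x => ∑ k, x k * Real.exp (chKL (P k) (chOut P x)) with hZ
  set g : (Fin m → ℝ) → ℝ := fun x => Real.exp (chKL (P i) (chOut P x)) / Z x with hg
  have hZs : Z lstar = Real.exp C := by
    simp only [hZ, hallC, ← Finset.sum_mul, hls.2, one_mul]
  have hZ0 : Z lstar ≠ 0 := hZs ▸ (Real.exp_pos C).ne'
  have hZc : ContDiffAt ℝ 2 Z lstar :=
    ContDiffAt.sum fun k _ => (contDiff_apply ℝ ℝ k).contDiffAt.mul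
      (contDiffAt_chKL P (P k) hQpos).exp
  have hgc : ContDiffAt ℝ 2 g lstar := (contDiffAt_chKL P (P i) hQpos).exp.div hZc hZ0
  have hF : (fun x => chAF P x i) = fun x => x i * g x := by
    funext x
    simp only [chAF, hg, hZ, mul_div_assoc]
  have hKL (a : Fin m) : ∃ E : (Fin m → ℝ) →L[ℝ] ℝ,
      HasFDerivAt (fun x => chKL (P a) (chOut P x)) E lstar ∧
        ∀ k, E (Pi.single k 1) = D2 a k := by
    refine ⟨_, hasFDerivAt_chKL P (P a) hQpos, fun k => ?_⟩
    rw [hD2, sum_apply, ← Finset.sum_neg_distrib]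
    refine Finset.sum_congr rfl fun j _ => ?_
    simp only [smul_apply, chOutCLM_apply, chOut_single, smul_eq_mul]
    ring
  choose E hE hED using hKL
  have hsum (k : Fin m) : ∑ a, lstar a * D2 a k = -1 := by
    simp only [hD2, mul_neg, Finset.sum_neg_distrib, Finset.mul_sum]
    rw [Finset.sum_comm, ← hProw k]
    congr 1
    refine Finset.sum_congr rfl fun j _ => ?_
    calc ∑ a, lstar a * (P k j * P a j / chOut P lstar j)
        = P k j / chOut P lstar j * chOut P lstar j := by
          conv_rhs => rw [chOut.eq_def P lstar j, Finset.mul_sum, ← chOut.eq_def P lstar j]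
          exact Finset.sum_congr rfl fun a _ => by ring
      _ = P k j := div_mul_cancel₀ _ (hQpos j).ne'
  have hZd := HasFDerivAt.fun_sum (u := Finset.univ) fun (k : Fin m) _ =>
    (hasFDerivAt_apply (𝕜 := ℝ) (F' := fun _ : Fin m => ℝ) k lstar).fun_mul (hE k).exp
  have hpdZ (k : Fin m) : fderiv ℝ Z lstar (Pi.single k 1) = 0 := by
    rw [hZd.fderiv]
    simp only [sum_apply, add_apply, smul_apply, hED, hallC, smul_eq_mul,
      ContinuousLinearMap.proj_apply, Finset.sum_add_distrib, ← Finset.mul_sum,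
      mul_left_comm _ (Real.exp C), hsum]
    simp
  have hpd (k : Fin m) : chPd g k lstar = D2 i k := by
    have h := (hE i).exp.fun_mul ((hasDerivAt_inv hZ0).comp_hasFDerivAt lstar
      (hZc.differentiableAt (by simp)).hasFDerivAt)
    simp only [Function.comp_apply, ← div_eq_mul_inv] at h
    rw [chPd, h.fderiv]
    simp [hpdZ, hED, hallC, hZs]
  rw [hF, chPd2_coord_mul hgc hi, hpd, hpd]
end
end
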